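/- Let k, n be positive integers with k < n, and let p₀,…,p_k ∈ ℝ^{1,n} be (k+1) points in general position. Then the Lorentzian distance-squared mapping L_{(p₀,…,p_k)} : ℝ^{1,n} → ℝ^{k+1} is A-equivalent to the normal form of Lorentzian indefinite fold mapping Ψ_k if and only if the recognition subspace V(p₀,…,p_k) is space-like. -/

import Mathlib

open scoped BigOperators

noncomputable section

/-- The Lorentzian inner product on `ℝ^{1,n}`, modeled as `Fin (n+1) → ℝ`:
`⟨x,y⟩ = -x₀y₀ + x₁y₁ + ⋯ + xₙyₙ`. -/
def lorIP {n : ℕ} (x y : Fin (n + 1) → ℝ) : ℝ :=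
  (∑ i, x i * y i) - 2 * (x 0 * y 0)

/-- The Euclidean inner product on `Fin m → ℝ`. -/
def eucIP {m : ℕ} (x y : Fin m → ℝ) : ℝ := ∑ i, x i * y i

/-- The Lorentzian distance-squared mapping determined by the points `p 0, …, p (m-1)`. -/
def LorDSM {n m : ℕ} (p : Fin m → Fin (n + 1) → ℝ) :
    (Fin (n + 1) → ℝ) → (Fin m → ℝ) :=
  fun x i => lorIP (x - p i) (x - p i)

/-- The Euclidean distance-squared mapping determined by the points `p 0, …, p (m-1)`. -/
def EucDSM {n m : ℕ} (p : Fin m → Fin (n + 1) → ℝ) :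
    (Fin (n + 1) → ℝ) → (Fin m → ℝ) :=
  fun x i => eucIP (x - p i) (x - p i)

/-- The recognition subspace `V(p₀, …, p_k)`: the span of the vectors `p i - p 0`. -/
def recSub {n k : ℕ} (p : Fin (k + 1) → Fin (n + 1) → ℝ) :
    Submodule ℝ (Fin (n + 1) → ℝ) :=
  Submodule.span ℝ (Set.range fun i => p i - p 0)

/-- The partial recognition subspace `V(p₀, …, p_j)`: the span of `p i - p 0` for `i ≤ j`. -/
def recSubUpTo {n k : ℕ} (p : Fin (k + 1) → Fin (n + 1) → ℝ) (j : ℕ) :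
    Submodule ℝ (Fin (n + 1) → ℝ) :=
  Submodule.span ℝ {v | ∃ i : Fin (k + 1), (i : ℕ) ≤ j ∧ v = p i - p 0}

/-- A subspace is time-like iff it contains a vector of negative Lorentzian square. -/
def LTimeLike {n : ℕ} (V : Submodule ℝ (Fin (n + 1) → ℝ)) : Prop :=
  ∃ v ∈ V, lorIP v v < 0

/-- A subspace is space-like iff every nonzero vector in it has positive Lorentzian square. -/
def LSpaceLike {n : ℕ} (V : Submodule ℝ (Fin (n + 1) → ℝ)) : Prop :=
  ∀ v ∈ V, v ≠ 0 → 0 < lorIP v v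

/-- A subspace is light-like iff it is neither time-like nor space-like. -/
def LLightLike {n : ℕ} (V : Submodule ℝ (Fin (n + 1) → ℝ)) : Prop :=
  ¬ LTimeLike V ∧ ¬ LSpaceLike V

/-- `f` and `g` are `𝒜`-equivalent: `g = H ∘ f ∘ h` for `C^∞` diffeomorphisms `h, H`. -/
def AEquiv {a b : ℕ} (f g : (Fin a → ℝ) → (Fin b → ℝ)) : Prop :=
  ∃ (h : (Fin a → ℝ) ≃ (Fin a → ℝ)) (H : (Fin b → ℝ) ≃ (Fin b → ℝ)),
    ContDiff ℝ (⊤ : ℕ∞) ⇑h ∧ ContDiff ℝ (⊤ : ℕ∞) ⇑h.symm ∧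
    ContDiff ℝ (⊤ : ℕ∞) ⇑H ∧ ContDiff ℝ (⊤ : ℕ∞) ⇑H.symm ∧
    g = ⇑H ∘ f ∘ ⇑h

theorem lorIP_comm {n : ℕ} (x y : Fin (n + 1) → ℝ) : lorIP x y = lorIP y x := by
  simp only [lorIP, mul_comm]

theorem lorIP_add_left {n : ℕ} (x y z : Fin (n + 1) → ℝ) :
    lorIP (x + y) z = lorIP x z + lorIP y z := by
  simp only [lorIP, Pi.add_apply, add_mul, Finset.sum_add_distrib]
  ring

theorem lorIP_smul_left {n : ℕ} (c : ℝ) (x y : Fin (n + 1) → ℝ) :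
    lorIP (c • x) y = c * lorIP x y := by
  simp only [lorIP, Pi.smul_apply, smul_eq_mul, mul_assoc, mul_sub, Finset.mul_sum]
  ring

/-- The Lorentzian inner product as a bilinear form. -/
def lorForm (n : ℕ) : LinearMap.BilinForm ℝ (Fin (n + 1) → ℝ) :=
  LinearMap.mk₂ ℝ lorIP lorIP_add_left lorIP_smul_left
    (fun x y z => by
      rw [lorIP_comm, lorIP_add_left, lorIP_comm y, lorIP_comm z])
    (fun c x y => by
      rw [lorIP_comm, lorIP_smul_left, lorIP_comm y, smul_eq_mul])

theorem lorForm_apply {n : ℕ} (x y : Fin (n + 1) → ℝ) : lorForm n x y = lorIP x y := rfl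

theorem lorIP_sub_sub {n : ℕ} (x y : Fin (n + 1) → ℝ) :
    lorIP (x - y) (x - y) = lorIP x x - 2 * lorIP x y + lorIP y y := by
  simp only [← lorForm_apply, map_sub, LinearMap.sub_apply]
  simp only [lorForm_apply, lorIP_comm y x]
  ring

theorem lorIP_eq_succ {n : ℕ} (x y : Fin (n + 1) → ℝ) :
    lorIP x y = (∑ i : Fin n, x i.succ * y i.succ) - x 0 * y 0 := by
  rw [lorIP, Fin.sum_univ_succ]
  ring

/-- A vector orthogonal to a nonzero causal vector is not time-like. -/
theorem lorIP_self_nonneg_of_orthogonal {n : ℕ} {x v : Fin (n + 1) → ℝ} (hv0 : v ≠ 0)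
    (hv : lorIP v v ≤ 0) (hxv : lorIP x v = 0) : 0 ≤ lorIP x x := by
  rw [lorIP_eq_succ] at *
  have hcs := Finset.sum_mul_sq_le_sq_mul_sq Finset.univ
    (fun i : Fin n => x i.succ) (fun i : Fin n => v i.succ)
  have hsq : ∀ y : Fin (n + 1) → ℝ,
      ∑ i : Fin n, y i.succ ^ 2 = ∑ i : Fin n, y i.succ * y i.succ := by
    intro y
    simp only [sq]
  rw [hsq, hsq] at hcs
  have hX : 0 ≤ ∑ i : Fin n, x i.succ * x i.succ :=
    Finset.sum_nonneg fun i _ => mul_self_nonneg _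
  have hv00 : v 0 ≠ 0 := by
    intro h0
    apply hv0
    have hs : ∑ i : Fin n, v i.succ * v i.succ = 0 :=
      le_antisymm (by simpa [h0] using hv) (Finset.sum_nonneg fun i _ => mul_self_nonneg _)
    rw [Finset.sum_eq_zero_iff_of_nonneg fun i _ => mul_self_nonneg _] at hs
    funext i
    refine Fin.cases h0 (fun j => ?_) i
    simpa using hs j (Finset.mem_univ _)
  have hpos : 0 < v 0 * v 0 := mul_self_pos.mpr hv00
  have hxv' : ∑ i : Fin n, x i.succ * v i.succ = x 0 * v 0 := by linarith
  rw [hxv'] at hcs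
  by_contra! hneg
  nlinarith [mul_le_mul_of_nonneg_left (sub_nonpos.mp hv) hX]

/-- The orthogonal complement of a space-like subspace contains a unit time-like vector. -/
theorem exists_unit_timeLike_orthogonal {n : ℕ} {V : Submodule ℝ (Fin (n + 1) → ℝ)}
    (hV : LSpaceLike V) : ∃ t, lorIP t t = -1 ∧ ∀ v ∈ V, lorIP t v = 0 := by
  let T : V →ₗ[ℝ] Module.Dual ℝ V := (lorForm n).domRestrict₁₂ V V
  have hT : Function.Injective T := by
    rw [injective_iff_map_eq_zero]
    intro v hv
    by_contra hne
    have h1 : lorIP (v : Fin (n + 1) → ℝ) v = 0 := LinearMap.congr_fun hv v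
    exact (hV v v.2 (by simpa using hne)).ne' h1
  have hTs : Function.Surjective T :=
    (LinearMap.injective_iff_surjective_of_finrank_eq_finrank
      Subspace.dual_finrank_eq.symm).mp hT
  let e : Fin (n + 1) → ℝ := Pi.single 0 1
  obtain ⟨v, hv⟩ := hTs ((lorForm n e).comp V.subtype)
  have hv' : ∀ w ∈ V, lorIP (v : Fin (n + 1) → ℝ) w = lorIP e w := fun w hw =>
    LinearMap.congr_fun hv ⟨w, hw⟩
  have hvv : 0 ≤ lorIP (v : Fin (n + 1) → ℝ) v := by
    by_cases h0 : (v : Fin (n + 1) → ℝ) = 0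
    · simp [h0, lorIP]
    · exact (hV v v.2 h0).le
  have hee : lorIP e e = -1 := by
    simp [lorIP_eq_succ, e]
  have hs : lorIP (e - v.1) (e - v.1) = -(1 + lorIP (v : Fin (n + 1) → ℝ) v) := by
    rw [lorIP_sub_sub, hee, ← hv' v v.2]
    ring
  set s := 1 + lorIP (v : Fin (n + 1) → ℝ) v with hsdef
  have hspos : 0 < s := by linarith
  refine ⟨(√s)⁻¹ • (e - v.1), ?_, fun w hw => ?_⟩
  · rw [lorIP_smul_left, lorIP_comm, lorIP_smul_left, hs, ← mul_assoc, ← mul_inv,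
      Real.mul_self_sqrt hspos.le]
    field_simp
  · rw [lorIP_smul_left, ← lorForm_apply, map_sub, LinearMap.sub_apply, lorForm_apply,
      lorForm_apply, hv' w hw, sub_self, mul_zero]

/-- Orthonormal bases adapted to a subspace and a unit vector orthogonal to it. -/
theorem exists_orthonormalBasis_adapted {E : Type*} [NormedAddCommGroup E]
    [InnerProductSpace ℝ E] {n k : ℕ} (hkn : k ≤ n) (hE : Module.finrank ℝ E = n + 1)
    (V : Submodule ℝ E) (hk : Module.finrank ℝ V = k) (t : E) (ht : inner ℝ t t = 1)
    (htV : ∀ v ∈ V, inner ℝ t v = 0) :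
    ∃ b : OrthonormalBasis (Fin (n + 1)) ℝ E, b 0 = t ∧
      V = Submodule.span ℝ (Set.range fun i : Fin k => b (Fin.castLE hkn i).succ) := by
  have : FiniteDimensional ℝ E := Module.finite_of_finrank_eq_succ hE
  let vb : OrthonormalBasis (Fin k) ℝ V := (stdOrthonormalBasis ℝ V).reindex (finCongr hk)
  let f : Fin (n + 1) → E :=
    Fin.cons t fun i => if h : (i : ℕ) < k then (vb ⟨i, h⟩ : E) else 0
  let s : Set (Fin (n + 1)) := {i | (i : ℕ) ≤ k}
  have hvb : ∀ i j : Fin k, inner ℝ (vb i : E) (vb j : E) = if i = j then (1 : ℝ) else 0 := by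
    intro i j
    rw [← Submodule.coe_inner]
    exact orthonormal_iff_ite.mp vb.orthonormal i j
  have hf : Orthonormal ℝ (s.domRestrict f) := by
    rw [orthonormal_iff_ite]
    rintro ⟨i, hi⟩ ⟨j, hj⟩
    rw [Set.domRestrict_apply, Set.domRestrict_apply]
    induction i using Fin.cases with
    | zero =>
      induction j using Fin.cases with
      | zero => simpa [f, -inner_self_eq_norm_sq_to_K] using ht
      | succ j =>
        have hj' : (j : ℕ) < k := by simpa [s] using hj
        simpa [f, hj', (Fin.succ_ne_zero j).symm] using htV _ (vb ⟨j, hj'⟩).2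
    | succ i =>
      have hi' : (i : ℕ) < k := by simpa [s] using hi
      induction j using Fin.cases with
      | zero =>
        rw [real_inner_comm]
        simpa [f, hi'] using htV _ (vb ⟨i, hi'⟩).2
      | succ j =>
        have hj' : (j : ℕ) < k := by simpa [s] using hj
        simp [f, hi', hj', hvb, Fin.ext_iff]
  obtain ⟨b, hb⟩ := hf.exists_orthonormalBasis_extension_of_card_eq (by simpa using hE)
  refine ⟨b, by simpa [f] using hb 0 (by simp [s]), ?_⟩
  have hbv : (fun i : Fin k => b (Fin.castLE hkn i).succ) = V.subtype ∘ vb := by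
    funext i
    rw [hb _ (by simp [s])]
    simp [f]
  rw [hbv, Set.range_comp, Submodule.span_image, ← vb.coe_toBasis, vb.toBasis.span_eq,
    Submodule.map_top, Submodule.range_subtype]

/-- Adapted orthonormal bases for a positive definite symmetric bilinear form. -/
theorem exists_basis_adapted_of_posDef {E : Type*} [AddCommGroup E] [Module ℝ E] {n k : ℕ}
    (hkn : k ≤ n) (hE : Module.finrank ℝ E = n + 1) (B : LinearMap.BilinForm ℝ E)
    (hsymm : ∀ x y, B x y = B y x) (hnonneg : ∀ x, 0 ≤ B x x) (hdef : ∀ x, B x x = 0 → x = 0)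
    (V : Submodule ℝ E) (hk : Module.finrank ℝ V = k) (t : E) (ht : B t t = 1)
    (htV : ∀ v ∈ V, B t v = 0) :
    ∃ b : Module.Basis (Fin (n + 1)) ℝ E, b 0 = t ∧
      V = Submodule.span ℝ (Set.range fun i : Fin k => b (Fin.castLE hkn i).succ) ∧
      ∀ x y, B x y = ∑ i, b.equivFun x i * b.equivFun y i := by
  let core : InnerProductSpace.Core ℝ E :=
    { inner := fun x y => B x y
      conj_inner_symm := fun x y => by simpa using hsymm y x
      re_inner_nonneg := fun x => by simpa using hnonneg x
      add_left := fun x y z => by simp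
      smul_left := fun x y r => by simp
      definite := hdef }
  let _ : NormedAddCommGroup E := core.toNormedAddCommGroup
  let _ : InnerProductSpace ℝ E := InnerProductSpace.ofCore core.toCore
  obtain ⟨b, hb0, hbV⟩ := exists_orthonormalBasis_adapted hkn hE V hk t ht htV
  refine ⟨b.toBasis, by simpa using hb0, by simpa using hbV, fun x y => ?_⟩
  have hxy : inner ℝ x y = B x y := rfl
  rw [← hxy, ← b.sum_inner_mul_inner x y]
  refine Finset.sum_congr rfl fun i _ => ?_
  simp [b.repr_apply_apply, real_inner_comm]

/-- A space-like subspace of dimension `k` is spanned by the vectors `b 1, …, b k` of some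
Lorentzian orthonormal basis `b`. -/
theorem exists_lorentz_basis_adapted {n k : ℕ} (hkn : k ≤ n)
    {V : Submodule ℝ (Fin (n + 1) → ℝ)} (hV : LSpaceLike V) (hk : Module.finrank ℝ V = k) :
    ∃ b : Module.Basis (Fin (n + 1)) ℝ (Fin (n + 1) → ℝ),
      V = Submodule.span ℝ (Set.range fun i : Fin k => b (Fin.castLE hkn i).succ) ∧
      ∀ x y, lorIP x y = lorIP (b.equivFun x) (b.equivFun y) := by
  obtain ⟨t, ht, htV⟩ := exists_unit_timeLike_orthogonal hV
  let B : LinearMap.BilinForm ℝ (Fin (n + 1) → ℝ) :=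
    lorForm n + (2 : ℝ) • ((lorForm n t).smulRight (lorForm n t))
  have hB : ∀ x y, B x y = lorIP x y + 2 * (lorIP t x * lorIP t y) := fun x y => rfl
  have ht0 : ∀ x, lorIP t x = 0 → lorIP x x ≤ 0 → x = 0 := by
    intro x htx hx
    by_contra hx0
    have := lorIP_self_nonneg_of_orthogonal hx0 hx htx
    linarith
  have hdecomp : ∀ x, ∃ y, lorIP t y = 0 ∧ B x x = lorIP y y + lorIP t x ^ 2 := by
    intro x
    refine ⟨x + lorIP t x • t, ?_, ?_⟩
    · rw [lorIP_comm, lorIP_add_left, lorIP_smul_left, ht, lorIP_comm]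
      ring
    · rw [hB]
      simp only [← lorForm_apply, map_add, LinearMap.add_apply, map_smul, LinearMap.smul_apply,
        smul_eq_mul]
      simp only [lorForm_apply, lorIP_comm x t, ht]
      ring
  have htne : t ≠ 0 := by
    rintro rfl
    simp [lorIP] at ht
  have hnonneg : ∀ x, 0 ≤ B x x := by
    intro x
    obtain ⟨y, hty, hxy⟩ := hdecomp x
    have := lorIP_self_nonneg_of_orthogonal htne (by linarith) ((lorIP_comm y t).trans hty)
    rw [hxy]
    positivity
  have hdef : ∀ x, B x x = 0 → x = 0 := by
    intro x hx
    obtain ⟨y, hty, hxy⟩ := hdecomp x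
    have := lorIP_self_nonneg_of_orthogonal htne (by linarith) ((lorIP_comm y t).trans hty)
    have htx : lorIP t x = 0 := by
      rw [← sq_eq_zero_iff]
      nlinarith [sq_nonneg (lorIP t x)]
    refine ht0 x htx ?_
    rw [hB, htx] at hx
    linarith
  obtain ⟨b, hb0, hbV, hbB⟩ := exists_basis_adapted_of_posDef hkn (by simp) B
    (fun x y => by rw [hB, hB, lorIP_comm x y]; ring) hnonneg hdef V hk t
    (by rw [hB, ht]; norm_num) (fun v hv => by rw [hB, htV v hv]; ring)
  refine ⟨b, hbV, fun x y => ?_⟩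
  have hcoord : ∀ x, lorIP t x = -b.equivFun x 0 := by
    intro x
    have h1 := hbB t x
    rw [hB, ht, ← hb0] at h1
    simp [Module.Basis.equivFun_self] at h1
    rw [hb0] at h1
    rw [Module.Basis.equivFun_apply]
    linarith
  have h2 := hbB x y
  rw [hB, hcoord, hcoord] at h2
  rw [lorIP.eq_def (b.equivFun x), ← h2]
  ring

/-- A Lorentzian distance-squared mapping is not onto unless its recognition subspace is
space-like. -/
theorem lSpaceLike_of_surjective_lorDSM {n k : ℕ} {p : Fin (k + 1) → Fin (n + 1) → ℝ}
    (hsurj : Function.Surjective (LorDSM p)) : LSpaceLike (recSub p) := by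
  intro v hv hv0
  by_contra! hle
  obtain ⟨x, hx⟩ := hsurj fun i => lorIP (p i - p 0) (p i - p 0) - 1
  have hx' : ∀ i, lorIP (x - p i) (x - p i) = lorIP (p i - p 0) (p i - p 0) - 1 := congrFun hx
  have h0 : lorIP (x - p 0) (x - p 0) = -1 := by
    rw [hx' 0]
    simp [lorIP]
  have horth : recSub p ≤ LinearMap.ker (lorForm n (x - p 0)) := by
    rw [recSub, Submodule.span_le]
    rintro _ ⟨i, rfl⟩
    have h1 := lorIP_sub_sub (x - p 0) (p i - p 0)
    rw [sub_sub_sub_cancel_right, hx' i, h0] at h1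
    rw [SetLike.mem_coe, LinearMap.mem_ker, lorForm_apply]
    linarith
  have := lorIP_self_nonneg_of_orthogonal hv0 hle (horth hv)
  linarith

/-- The normal form of Lorentzian indefinite fold mappings. -/
def lorentzFold {k n : ℕ} (hkn : k ≤ n) (x : Fin (n + 1) → ℝ) (i : Fin (k + 1)) : ℝ :=
  if h : (i : ℕ) < k then x (Fin.castLE hkn ⟨i, h⟩).succ
  else -x 0 ^ 2 + ∑ j : Fin (n + 1), if k + 1 ≤ (j : ℕ) then x j ^ 2 else 0

/-- The normal form of Lorentzian indefinite fold mappings is onto. -/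
theorem lorentzFold_surjective {k n : ℕ} (hkn : k < n) :
    Function.Surjective (lorentzFold hkn.le) := by
  intro z
  obtain ⟨a, c, hac⟩ : ∃ a c : ℝ, -a ^ 2 + c ^ 2 = z (Fin.last k) :=
    ⟨(z (Fin.last k) - 1) / 2, (z (Fin.last k) + 1) / 2, by ring⟩
  refine ⟨fun j => if h0 : (j : ℕ) = 0 then a else if h : (j : ℕ) ≤ k then
    z ⟨(j : ℕ) - 1, by omega⟩ else if (j : ℕ) = n then c else 0, ?_⟩
  funext i
  induction i using Fin.lastCases with
  | cast i => simp [lorentzFold, Fin.castSucc, Fin.castAdd, Fin.castLE]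
  | last =>
    have hn0 : n ≠ 0 := by omega
    rw [lorentzFold, dif_neg (by simp), Finset.sum_eq_single (Fin.last n)]
    · simp [hn0, hkn.not_ge, Nat.succ_le_iff.mpr hkn, hac]
    · intro j _ hj
      have hjn : (j : ℕ) ≠ n := fun h => hj (Fin.ext h)
      split_ifs <;> first | omega | simp
    · simp

/-- A Lorentzian distance-squared mapping with space-like recognition subspace is equivalent to
the normal form of Lorentzian indefinite fold mappings. -/
theorem aEquiv_lorentzFold_of_lSpaceLike {k n : ℕ} (hkn : k < n)
    {p : Fin (k + 1) → Fin (n + 1) → ℝ} (hgen : Module.finrank ℝ (recSub p) = k)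
    (hV : LSpaceLike (recSub p)) :
    AEquiv (LorDSM p) (lorentzFold hkn.le) := by
  obtain ⟨b, hbV, hb⟩ := exists_lorentz_basis_adapted hkn.le hV hgen
  let ι : Fin k → Fin (n + 1) := fun i => (Fin.castLE hkn.le i).succ
  have hι : Function.Injective ι := fun i j hij => by simpa [ι] using hij
  let q : Fin k → Fin (n + 1) → ℝ := fun i => p i.succ - p 0
  have hq : ∀ i, q i ∈ recSub p := fun i => Submodule.subset_span ⟨i.succ, rfl⟩
  have hbb : ∀ i j, i ≠ j → lorIP (b i) (b j) = 0 := by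
    intro i j hij
    rw [hb]
    simp [lorIP, Module.Basis.equivFun_self, Finset.sum_ite_eq]
    grind
  have horth : ∀ j, j ∉ Set.range ι → ∀ v ∈ recSub p, lorIP (b j) v = 0 := by
    intro j hj v hv
    have hle : recSub p ≤ LinearMap.ker (lorForm n (b j)) := by
      rw [hbV, Submodule.span_le]
      rintro _ ⟨i, rfl⟩
      exact hbb _ _ fun h => hj ⟨i, h.symm⟩
    exact hle hv
  let S : (Fin k → ℝ) →ₗ[ℝ] (Fin (n + 1) → ℝ) := Fintype.linearCombination ℝ (b ∘ ι)
  have hS : ∀ u, S u = ∑ i, u i • b (ι i) := fun u => Fintype.linearCombination_apply ..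
  have hSV : ∀ u, S u ∈ recSub p := by
    intro u
    rw [hS, hbV]
    exact Submodule.sum_mem _ fun i _ =>
      Submodule.smul_mem _ _ (Submodule.subset_span ⟨i, rfl⟩)
  let M : (Fin k → ℝ) →ₗ[ℝ] (Fin k → ℝ) :=
    LinearMap.pi fun i => (lorForm n (q i)).comp S
  have hM : ∀ u i, M u i = lorIP (q i) (S u) := fun u i => rfl
  have hMinj : Function.Injective M := by
    rw [injective_iff_map_eq_zero]
    intro u hu
    have hle : recSub p ≤ LinearMap.ker ((lorForm n).flip (S u)) := by
      rw [recSub, Submodule.span_le]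
      rintro _ ⟨i, rfl⟩
      induction i using Fin.cases with
      | zero => simp
      | succ i => exact congrFun hu i
    have hS0 : S u = 0 := by
      by_contra hne
      exact (hV _ (hSV u) hne).ne' (hle (hSV u))
    funext i
    have hli : LinearIndependent ℝ (b ∘ ι) := b.linearIndependent.comp ι hι
    exact Fintype.linearIndependent_iff.mp hli u ((hS u).symm.trans hS0) i
  let A : (Fin k → ℝ) ≃ₗ[ℝ] (Fin k → ℝ) := LinearEquiv.ofInjectiveEndo M hMinj
  have hA : ∀ u, A u = M u := fun u => rfl
  have hAc : ContDiff ℝ (⊤ : ℕ∞) A := A.toContinuousLinearEquiv.contDiff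
  have hAsc : ContDiff ℝ (⊤ : ℕ∞) A.symm := A.symm.toContinuousLinearEquiv.contDiff
  let D : (Fin (k + 1) → ℝ) → Fin k → ℝ := fun z i =>
    (lorIP (q i) (q i) + z 0 - z i.succ) / 2
  have hD : ContDiff ℝ (⊤ : ℕ∞) D := by
    refine contDiff_pi.mpr fun i => ?_
    fun_prop
  let H : (Fin (k + 1) → ℝ) ≃ (Fin (k + 1) → ℝ) :=
    { toFun := fun z => Fin.snoc (A.symm (D z)) (z 0 - ∑ i, A.symm (D z) i ^ 2)
      invFun := fun w => Fin.cons (w (Fin.last k) + ∑ i : Fin k, w i.castSucc ^ 2) fun i =>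
        lorIP (q i) (q i) + (w (Fin.last k) + ∑ i : Fin k, w i.castSucc ^ 2)
          - 2 * A (fun j => w j.castSucc) i
      left_inv := fun z => by
        funext i
        induction i using Fin.cases with
        | zero => simp
        | succ i =>
          simp only [Fin.cons_succ, Fin.snoc_castSucc, Fin.snoc_last]
          rw [show (fun j => A.symm (D z) j) = A.symm (D z) from rfl, A.apply_symm_apply]
          simp only [D]
          ring
      right_inv := fun w => by
        have hDw : D (Fin.cons (w (Fin.last k) + ∑ i : Fin k, w i.castSucc ^ 2) fun i =>
            lorIP (q i) (q i) + (w (Fin.last k) + ∑ i : Fin k, w i.castSucc ^ 2)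
              - 2 * A (fun j => w j.castSucc) i) = A (fun j => w j.castSucc) := by
          funext i
          simp only [D, Fin.cons_succ, Fin.cons_zero]
          ring
        funext i
        dsimp only
        rw [hDw, A.symm_apply_apply]
        induction i using Fin.lastCases with
        | last => simp
        | cast i => simp }
  refine ⟨b.equivFun.symm.toEquiv.trans (Equiv.addLeft (p 0)), H, ?_, ?_, ?_, ?_, ?_⟩
  · exact contDiff_const.add b.equivFun.symm.toContinuousLinearEquiv.contDiff
  · exact b.equivFun.toContinuousLinearEquiv.contDiff.comp
      (contDiff_const.add contDiff_id)
  · have hAD : ContDiff ℝ (⊤ : ℕ∞) fun z => A.symm (D z) := hAsc.comp hD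
    refine contDiff_pi.mpr fun i => ?_
    induction i using Fin.lastCases with
    | last =>
      simp only [H, Equiv.coe_fn_mk, Fin.snoc_last]
      fun_prop
    | cast i =>
      simp only [H, Equiv.coe_fn_mk, Fin.snoc_castSucc]
      fun_prop
  · have hAw : ContDiff ℝ (⊤ : ℕ∞) fun w : Fin (k + 1) → ℝ => A fun j => w j.castSucc :=
      hAc.comp (by fun_prop)
    refine contDiff_pi.mpr fun i => ?_
    induction i using Fin.cases with
    | zero =>
      simp only [H, Equiv.coe_fn_symm_mk, Fin.cons_zero]
      fun_prop
    | succ i =>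
      simp only [H, Equiv.coe_fn_symm_mk, Fin.cons_succ]
      fun_prop
  · funext y
    set x := b.equivFun.symm y with hx
    have hL : ∀ i, LorDSM p (p 0 + x) i = lorIP (x - (p i - p 0)) (x - (p i - p 0)) := by
      intro i
      rw [LorDSM, show p 0 + x - p i = x - (p i - p 0) by abel]
    have hL0 : LorDSM p (p 0 + x) 0 = lorIP x x := by
      rw [hL, sub_self, sub_zero]
    have hDL : D (LorDSM p (p 0 + x)) = A fun i => y (ι i) := by
      funext i
      have hxS : lorIP (q i) x = lorIP (q i) (S fun i => y (ι i)) := by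
        rw [hx, b.equivFun_symm_apply, hS, ← lorForm_apply, ← lorForm_apply, map_sum, map_sum]
        refine (Finset.sum_of_injOn ι hι.injOn (by simp) (fun j _ hj => ?_) (by simp)).symm
        rw [map_smul, lorForm_apply, lorIP_comm, horth j (by simpa using hj) _ (hq i),
          smul_zero]
      rw [hA, hM, ← hxS, lorIP_comm]
      simp only [D, hL0, hL, lorIP_sub_sub x, q]
      ring
    have hxx : lorIP x x = (∑ j, y j * y j) - 2 * (y 0 * y 0) := by
      rw [hb, hx, LinearEquiv.apply_symm_apply, lorIP]
    have hH : (H ∘ LorDSM p ∘ b.equivFun.symm.toEquiv.trans (Equiv.addLeft (p 0))) y =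
        Fin.snoc (fun i => y (ι i)) (lorIP x x - ∑ i, y (ι i) ^ 2) := by
      change Fin.snoc (α := fun _ => ℝ) (A.symm (D (LorDSM p (p 0 + x))))
        (LorDSM p (p 0 + x) 0 - ∑ i, A.symm (D (LorDSM p (p 0 + x))) i ^ 2) = _
      rw [hDL, A.symm_apply_apply, hL0]
    rw [hH]
    funext i
    induction i using Fin.lastCases with
    | cast i =>
      rw [Fin.snoc_castSucc, lorentzFold, dif_pos (by simp)]
      rfl
    | last =>
      rw [Fin.snoc_last, lorentzFold, dif_neg (by simp), hxx]
      have hsum : ∑ i, y (ι i) ^ 2 =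
          ∑ j : Fin (n + 1), if j ≠ 0 ∧ (j : ℕ) ≤ k then y j ^ 2 else 0 := by
        refine Finset.sum_of_injOn ι hι.injOn (by simp) (fun j _ hj => ?_) (fun i _ => ?_)
        · rw [if_neg]
          rintro ⟨hj0, hjk⟩
          obtain ⟨m, rfl⟩ := Fin.exists_succ_eq.mpr hj0
          exact hj ⟨⟨m, by simpa using hjk⟩, by simp, by simp [ι]⟩
        · rw [if_pos]
          exact ⟨Fin.succ_ne_zero _, by simp [ι]⟩
      rw [hsum, Fin.sum_univ_succ, Fin.sum_univ_succ, Fin.sum_univ_succ]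
      have hsplit : ∑ j : Fin n, y j.succ * y j.succ =
          (∑ j : Fin n, if j.succ ≠ 0 ∧ (j.succ : ℕ) ≤ k then y j.succ ^ 2 else 0) +
          ∑ j : Fin n, if k + 1 ≤ (j.succ : ℕ) then y j.succ ^ 2 else 0 := by
        rw [← Finset.sum_add_distrib]
        refine Finset.sum_congr rfl fun j _ => ?_
        by_cases hj : (j.succ : ℕ) ≤ k
        · rw [if_pos ⟨Fin.succ_ne_zero _, hj⟩, if_neg (by omega)]
          ring
        · rw [if_neg fun h => hj h.2, if_pos (by omega)]
          ring
      rw [hsplit, if_neg (by simp), if_neg (by simp)]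
      ring

theorem theorem1_1b (k n : ℕ) (hk : 1 ≤ k) (hkn : k < n)
    (p : Fin (k + 1) → Fin (n + 1) → ℝ)
    (hgen : Module.finrank ℝ (recSub p) = k) :
    AEquiv (LorDSM p)
        (fun (x : Fin (n + 1) → ℝ) (i : Fin (k + 1)) =>
          if h : (i : ℕ) < k then x ⟨(i : ℕ) + 1, by omega⟩
          else -x 0 ^ 2 + ∑ j : Fin (n + 1), if k + 1 ≤ (j : ℕ) then x j ^ 2 else 0)
      ↔ LSpaceLike (recSub p) := by
  change AEquiv (LorDSM p) (lorentzFold hkn.le) ↔ _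
  refine ⟨?_, aEquiv_lorentzFold_of_lSpaceLike hkn hgen⟩
  rintro ⟨h, H, -, -, -, -, hgf⟩
  have hs := lorentzFold_surjective hkn
  rw [hgf] at hs
  have hs' : Function.Surjective (LorDSM p ∘ h) := by
    simpa using H.symm.surjective.comp hs
  exact lSpaceLike_of_surjective_lorDSM hs'.of_comp
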